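/- Let Ω = O(n) × 𝔇 be the product of the set of n×n orthogonal matrices and the set of diagonal 4th-order tensors, and let f : Ω → ℝ^{n×n×n×n} be the map f(Q, S) = S ×₁Q ×₂Q ×₃Q ×₄Q, with Df_u denoting its first-order differential (Jacobian) at the point u (of the natural extension of f to all matrix-tensor pairs). Suppose ‖S‖_F ≤ R for all points considered. Then for all u, u' ∈ Ω with ‖u − u'‖₂ ≤ 2ε₀, ‖f(u) − f(u') − Df_{u'}ᵀ(u − u')‖_F ≤ C₁ · ‖u − u'‖₂², where C₁ = n²(n+1)²·max{3R, 1}. -/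

import Mathlib

open scoped BigOperators
open MeasureTheory ProbabilityTheory Matrix
open scoped NNReal ENNReal

noncomputable section

/-- 4th-order tensors over ℝⁿ. -/
abbrev T4 (n : ℕ) := Fin n → Fin n → Fin n → Fin n → ℝ

/-- Squared Frobenius norm of a 4th-order tensor. -/
def frobSq {n : ℕ} (S : T4 n) : ℝ := ∑ i, ∑ j, ∑ k, ∑ l, (S i j k l) ^ 2

/-- Frobenius norm of a 4th-order tensor. -/
def frob {n : ℕ} (S : T4 n) : ℝ := Real.sqrt (frobSq S)

/-- Vectorization of a 4th-order tensor. -/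
def tvec {n : ℕ} (S : T4 n) : Fin n × Fin n × Fin n × Fin n → ℝ :=
  fun x => S x.1 x.2.1 x.2.2.1 x.2.2.2

/-- Squared Euclidean norm. -/
def l2Sq {ι : Type*} [Fintype ι] (v : ι → ℝ) : ℝ := ∑ i, (v i) ^ 2

/-- Euclidean norm. -/
def l2 {ι : Type*} [Fintype ι] (v : ι → ℝ) : ℝ := Real.sqrt (l2Sq v)

/-- Multilinear transform of a 4th-order tensor by four matrices. -/
def mulT {n : ℕ} (S : T4 n) (A B C D : Matrix (Fin n) (Fin n) ℝ) : T4 n :=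
  fun i j k l => ∑ p, ∑ q, ∑ r, ∑ s, A i p * B j q * C k r * D l s * S p q r s

/-- Diagonal 4th-order tensors with diagonal entries at least `εS`. -/
def IsDiagT {n : ℕ} (εS : ℝ) (S : T4 n) : Prop :=
  (∀ i j k l, ¬ (j = i ∧ k = i ∧ l = i) → S i j k l = 0) ∧ ∀ i, εS ≤ S i i i i

/-- The ICA model set. -/
def ICAset (n : ℕ) (εS : ℝ) : Set (T4 n) :=
  { Z | ∃ S Q, IsDiagT εS S ∧ Qᵀ * Q = 1 ∧ Z = mulT S Q Q Q Q }

/-- The i.i.d.-Gaussian-entries (mean 0, variance 1/m) measure on m×p matrices,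
with p indexed by 4-tuples. -/
def gaussMat (m n : ℕ) :
    Measure (Fin m → (Fin n × Fin n × Fin n × Fin n) → ℝ) :=
  Measure.pi fun _ : Fin m =>
    Measure.pi fun _ : Fin n × Fin n × Fin n × Fin n =>
      gaussianReal 0 ((m : ℝ≥0))⁻¹

/-- The restricted isometry property with constant δ on the ICA model set. -/
def RIPset (n m : ℕ) (εS δ : ℝ) :
    Set (Fin m → (Fin n × Fin n × Fin n × Fin n) → ℝ) :=
  { A | ∀ Z₁ ∈ ICAset n εS, ∀ Z₂ ∈ ICAset n εS,
      (1 - δ) * frobSq (Z₁ - Z₂) ≤ l2Sq ((Matrix.of A).mulVec (tvec (Z₁ - Z₂))) ∧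
      l2Sq ((Matrix.of A).mulVec (tvec (Z₁ - Z₂))) ≤ (1 + δ) * frobSq (Z₁ - Z₂) }


/-- The diagonal 4th-order tensor with diagonal entries `d`. -/
def diagT {n : ℕ} (d : Fin n → ℝ) : T4 n :=
  fun i j k l => if j = i ∧ k = i ∧ l = i then d i else 0

/-- The parametrization map f(Q,S) = S ×₁Q ×₂Q ×₃Q ×₄Q, viewed as a smooth map on
the n² entries of Q and the n diagonal entries of S. -/
def Fmap {n : ℕ} (u : (Fin n → Fin n → ℝ) × (Fin n → ℝ)) : T4 n :=
  mulT (diagT u.2) (Matrix.of u.1) (Matrix.of u.1) (Matrix.of u.1) (Matrix.of u.1)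

/-- Squared Euclidean norm ‖u‖₂² = ‖Q‖_F² + ‖S‖₂² on the parameter space. -/
def paramNormSq {n : ℕ} (u : (Fin n → Fin n → ℝ) × (Fin n → ℝ)) : ℝ :=
  (∑ i, ∑ j, (u.1 i j) ^ 2) + ∑ i, (u.2 i) ^ 2

/-- Euclidean norm on the parameter space. -/
def paramNorm {n : ℕ} (u : (Fin n → Fin n → ℝ) × (Fin n → ℝ)) : ℝ :=
  Real.sqrt (paramNormSq u)

/-- Membership in Ω = O(n) × 𝔇. -/
def inOmega {n : ℕ} (εS : ℝ) (u : (Fin n → Fin n → ℝ) × (Fin n → ℝ)) : Prop :=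
  (Matrix.of u.1)ᵀ * Matrix.of u.1 = 1 ∧ ∀ i, εS ≤ u.2 i

/-- The coordinate direction corresponding to the matrix entry Q_{ij}. -/
def dirQ {n : ℕ} (i j : Fin n) : (Fin n → Fin n → ℝ) × (Fin n → ℝ) :=
  (fun a b => if a = i ∧ b = j then (1 : ℝ) else 0, 0)

/-- The coordinate direction corresponding to the diagonal entry S_{kkkk}. -/
def dirS {n : ℕ} (k : Fin n) : (Fin n → Fin n → ℝ) × (Fin n → ℝ) :=
  (0, Pi.single k 1)

lemma Fmap_apply {n : ℕ} (u : (Fin n → Fin n → ℝ) × (Fin n → ℝ)) (i j k l : Fin n) :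
    Fmap u i j k l = ∑ p, u.1 i p * u.1 j p * u.1 k p * u.1 l p * u.2 p := by
  simp only [Fmap, mulT, diagT, Matrix.of_apply]
  refine Finset.sum_congr rfl fun p _ => ?_
  rw [Finset.sum_eq_single p (fun q _ hq => by simp [hq]) (by simp),
    Finset.sum_eq_single p (fun q _ hq => by simp [hq]) (by simp),
    Finset.sum_eq_single p (fun q _ hq => by simp [hq]) (by simp)]
  simp

lemma differentiable_Fmap {n : ℕ} :
    Differentiable ℝ (Fmap : (Fin n → Fin n → ℝ) × (Fin n → ℝ) → T4 n) := by
  have h : (Fmap : (Fin n → Fin n → ℝ) × (Fin n → ℝ) → T4 n) = fun u i j k l =>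
      ∑ p, u.1 i p * u.1 j p * u.1 k p * u.1 l p * u.2 p := by
    funext u i j k l
    exact Fmap_apply u i j k l
  rw [h]
  fun_prop

lemma fderiv_Fmap_apply {n : ℕ} (u v : (Fin n → Fin n → ℝ) × (Fin n → ℝ)) (i j k l : Fin n) :
    fderiv ℝ Fmap u v i j k l =
      ∑ p, (v.1 i p * u.1 j p * u.1 k p * u.1 l p * u.2 p
        + u.1 i p * v.1 j p * u.1 k p * u.1 l p * u.2 p
        + u.1 i p * u.1 j p * v.1 k p * u.1 l p * u.2 p
        + u.1 i p * u.1 j p * u.1 k p * v.1 l p * u.2 p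
        + u.1 i p * u.1 j p * u.1 k p * u.1 l p * v.2 p) := by
  have hline : HasDerivAt (fun t : ℝ => u + t • v) v 0 := by
    simpa using ((hasDerivAt_id (0 : ℝ)).smul_const v).const_add u
  have hF : HasFDerivAt Fmap (fderiv ℝ Fmap u) (u + (0 : ℝ) • v) := by
    simpa using (differentiable_Fmap u).hasFDerivAt
  have hcomp := hF.comp_hasDerivAt (0 : ℝ) hline
  have hentry : HasDerivAt (fun t : ℝ => Fmap (u + t • v) i j k l)
      (fderiv ℝ Fmap u v i j k l) 0 :=
    hasDerivAt_pi.1 (hasDerivAt_pi.1 (hasDerivAt_pi.1 (hasDerivAt_pi.1 hcomp i) j) k) l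
  have haff (a b : ℝ) : HasDerivAt (fun t : ℝ => a + t * b) b 0 := by
    simpa using ((hasDerivAt_id (0 : ℝ)).mul_const b).const_add a
  refine hentry.unique ?_
  simp only [Fmap_apply, Prod.fst_add, Prod.snd_add, Prod.smul_fst, Prod.smul_snd,
    Pi.add_apply, Pi.smul_apply, smul_eq_mul]
  refine HasDerivAt.fun_sum fun p _ => ?_
  refine (((((haff (u.1 i p) (v.1 i p)).fun_mul (haff (u.1 j p) (v.1 j p))).fun_mul
    (haff (u.1 k p) (v.1 k p))).fun_mul (haff (u.1 l p) (v.1 l p))).fun_mul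
    (haff (u.2 p) (v.2 p))).congr_deriv ?_
  ring

lemma abs_apply_le_one_of_transpose_mul_self {n : ℕ} {Q : Fin n → Fin n → ℝ}
    (hQ : (Matrix.of Q)ᵀ * Matrix.of Q = 1) (i p : Fin n) : |Q i p| ≤ 1 := by
  have h : ∑ a, Q a p ^ 2 = 1 := by
    simpa [Matrix.mul_apply, sq] using congrFun (congrFun hQ p) p
  rw [← sq_le_one_iff_abs_le_one, ← h]
  exact Finset.single_le_sum (f := fun a => Q a p ^ 2) (fun a _ => sq_nonneg _)
    (Finset.mem_univ i)

lemma abs_apply_le_frob {n : ℕ} (T : T4 n) (i j k l : Fin n) : |T i j k l| ≤ frob T := by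
  refine Real.abs_le_sqrt ?_
  calc T i j k l ^ 2 ≤ ∑ l, T i j k l ^ 2 :=
        Finset.single_le_sum (f := fun l => T i j k l ^ 2)
          (fun _ _ => by positivity) (Finset.mem_univ l)
    _ ≤ ∑ k, ∑ l, T i j k l ^ 2 :=
        Finset.single_le_sum (f := fun k => ∑ l, T i j k l ^ 2)
          (fun _ _ => by positivity) (Finset.mem_univ k)
    _ ≤ ∑ j, ∑ k, ∑ l, T i j k l ^ 2 :=
        Finset.single_le_sum (f := fun j => ∑ k, ∑ l, T i j k l ^ 2)
          (fun _ _ => by positivity) (Finset.mem_univ j)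
    _ ≤ frobSq T :=
        Finset.single_le_sum (f := fun i => ∑ j, ∑ k, ∑ l, T i j k l ^ 2)
          (fun _ _ => by positivity) (Finset.mem_univ i)

lemma abs_le_frob_diagT {n : ℕ} (d : Fin n → ℝ) (p : Fin n) : |d p| ≤ frob (diagT d) := by
  simpa [diagT] using abs_apply_le_frob (diagT d) p p p p

lemma frob_le_of_forall_abs_le {n : ℕ} {T : T4 n} {B : ℝ} (hB : 0 ≤ B)
    (hT : ∀ i j k l, |T i j k l| ≤ B) : frob T ≤ (n : ℝ) ^ 2 * B := by
  refine Real.sqrt_le_iff.2 ⟨by positivity, ?_⟩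
  calc frobSq T ≤ ∑ _i : Fin n, ∑ _j : Fin n, ∑ _k : Fin n, ∑ _l : Fin n, B ^ 2 := by
        unfold frobSq
        refine Finset.sum_le_sum fun i _ => Finset.sum_le_sum fun j _ =>
          Finset.sum_le_sum fun k _ => Finset.sum_le_sum fun l _ => ?_
        exact sq_le_sq' (abs_le.1 (hT i j k l)).1 (abs_le.1 (hT i j k l)).2
    _ = ((n : ℝ) ^ 2 * B) ^ 2 := by
        simp only [Finset.sum_const, Finset.card_univ, Fintype.card_fin, nsmul_eq_mul]
        ring

lemma abs_mul_le_half_add_sq {x y u v w R : ℝ} (hu : |u| ≤ 1) (hv : |v| ≤ 1) (hw : |w| ≤ R) :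
    |x * y * (u * v * w)| ≤ R / 2 * (x ^ 2 + y ^ 2) := by
  have hR : 0 ≤ R := (abs_nonneg w).trans hw
  have hxy : |x| * |y| ≤ (x ^ 2 + y ^ 2) / 2 := by
    nlinarith [sq_nonneg (|x| - |y|), sq_abs x, sq_abs y]
  have huvw : |u| * |v| * |w| ≤ 1 * 1 * R := by gcongr
  simp only [abs_mul]
  calc |x| * |y| * (|u| * |v| * |w|) ≤ (x ^ 2 + y ^ 2) / 2 * (1 * 1 * R) := by gcongr
    _ = R / 2 * (x ^ 2 + y ^ 2) := by ring

/-- Second-order Taylor remainder of the product of five real numbers, four of which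
are bounded by `1` and the last by `R`. -/
lemma abs_prod_five_taylor_remainder_le {R a b c d s a' b' c' d' s' : ℝ}
    (hc : |c| ≤ 1) (hd : |d| ≤ 1) (hs : |s| ≤ R)
    (ha' : |a'| ≤ 1) (hb' : |b'| ≤ 1) (hc' : |c'| ≤ 1) (hd' : |d'| ≤ 1) :
    |a * b * c * d * s - a' * b' * c' * d' * s' -
      ((a - a') * b' * c' * d' * s' + a' * (b - b') * c' * d' * s' + a' * b' * (c - c') * d' * s'
        + a' * b' * c' * (d - d') * s' + a' * b' * c' * d' * (s - s'))| ≤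
      (3 * R + 1) / 2 * ((a - a') ^ 2 + (b - b') ^ 2 + (c - c') ^ 2 + (d - d') ^ 2)
        + 2 * (s - s') ^ 2 := by
  have hab := abs_le.1 (abs_mul_le_half_add_sq (x := a - a') (y := b - b') hc hd hs)
  have hac := abs_le.1 (abs_mul_le_half_add_sq (x := a - a') (y := c - c') hb' hd hs)
  have hbc := abs_le.1 (abs_mul_le_half_add_sq (x := b - b') (y := c - c') ha' hd hs)
  have had := abs_le.1 (abs_mul_le_half_add_sq (x := a - a') (y := d - d') hb' hc' hs)
  have hbd := abs_le.1 (abs_mul_le_half_add_sq (x := b - b') (y := d - d') ha' hc' hs)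
  have hcd := abs_le.1 (abs_mul_le_half_add_sq (x := c - c') (y := d - d') ha' hb' hs)
  have has := abs_le.1 (abs_mul_le_half_add_sq (x := a - a') (y := s - s') hb' hc' hd')
  have hbs := abs_le.1 (abs_mul_le_half_add_sq (x := b - b') (y := s - s') ha' hc' hd')
  have hcs := abs_le.1 (abs_mul_le_half_add_sq (x := c - c') (y := s - s') ha' hb' hd')
  have hds := abs_le.1 (abs_mul_le_half_add_sq (x := d - d') (y := s - s') ha' hb' hc')
  rw [abs_le]
  constructor <;> linarith

lemma abs_Fmap_taylor_remainder_apply_le {n : ℕ} {R : ℝ}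
    {u u' : (Fin n → Fin n → ℝ) × (Fin n → ℝ)}
    (hQ : ∀ i p, |u.1 i p| ≤ 1) (hQ' : ∀ i p, |u'.1 i p| ≤ 1) (hS : ∀ p, |u.2 p| ≤ R)
    (i j k l : Fin n) :
    |(Fmap u - Fmap u' - fderiv ℝ Fmap u' (u - u')) i j k l| ≤
      4 * max (3 * R) 1 * paramNormSq (u - u') := by
  have hrow (a : Fin n) :
      ∑ p, (u.1 a p - u'.1 a p) ^ 2 ≤ ∑ a, ∑ p, (u.1 a p - u'.1 a p) ^ 2 :=
    Finset.single_le_sum (f := fun a => ∑ p, (u.1 a p - u'.1 a p) ^ 2)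
      (fun _ _ => by positivity) (Finset.mem_univ a)
  have hR : 0 ≤ R := (abs_nonneg _).trans (hS i)
  have hX : 0 ≤ ∑ a, ∑ p, (u.1 a p - u'.1 a p) ^ 2 := by positivity
  have hY : 0 ≤ ∑ p, (u.2 p - u'.2 p) ^ 2 := by positivity
  have hnorm : paramNormSq (u - u') =
      (∑ a, ∑ p, (u.1 a p - u'.1 a p) ^ 2) + ∑ p, (u.2 p - u'.2 p) ^ 2 := rfl
  simp only [Pi.sub_apply]
  rw [fderiv_Fmap_apply, Fmap_apply, Fmap_apply, ← Finset.sum_sub_distrib,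
    ← Finset.sum_sub_distrib, hnorm]
  simp only [Prod.fst_sub, Prod.snd_sub, Pi.sub_apply]
  calc
    _ ≤ ∑ p, ((3 * R + 1) / 2 * ((u.1 i p - u'.1 i p) ^ 2 + (u.1 j p - u'.1 j p) ^ 2
          + (u.1 k p - u'.1 k p) ^ 2 + (u.1 l p - u'.1 l p) ^ 2)
          + 2 * (u.2 p - u'.2 p) ^ 2) :=
      (Finset.abs_sum_le_sum_abs _ _).trans <| Finset.sum_le_sum fun p _ =>
        abs_prod_five_taylor_remainder_le (hQ k p) (hQ l p) (hS p)
          (hQ' i p) (hQ' j p) (hQ' k p) (hQ' l p)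
    _ = (3 * R + 1) / 2 * (∑ p, (u.1 i p - u'.1 i p) ^ 2 + ∑ p, (u.1 j p - u'.1 j p) ^ 2
          + ∑ p, (u.1 k p - u'.1 k p) ^ 2 + ∑ p, (u.1 l p - u'.1 l p) ^ 2)
          + 2 * ∑ p, (u.2 p - u'.2 p) ^ 2 := by
      simp only [Finset.sum_add_distrib, ← Finset.mul_sum]
    _ ≤ (3 * R + 1) / 2 * (4 * ∑ a, ∑ p, (u.1 a p - u'.1 a p) ^ 2)
          + 2 * ∑ p, (u.2 p - u'.2 p) ^ 2 := by
      gcongr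
      linarith [hrow i, hrow j, hrow k, hrow l]
    _ ≤ _ := by
      nlinarith [mul_le_mul_of_nonneg_right (le_max_left (3 * R) 1) hX,
        mul_le_mul_of_nonneg_right (le_max_right (3 * R) 1) hX,
        mul_le_mul_of_nonneg_right (le_max_right (3 * R) 1) hY]

/-- Taylor approximation error, Lemma A.2.  For u, u' ∈ Ω with
‖S‖_F ≤ R and ‖u − u'‖₂ ≤ 2ε₀,
‖f(u) − f(u') − Df_{u'}ᵀ(u − u')‖_F ≤ n²(n+1)²·max{3R,1}·‖u − u'‖₂². -/
theorem taylor_approximation_error (n : ℕ) (εS R ε₀ : ℝ)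
    (hεS : 0 < εS) (hR : 0 < R) (hε₀ : 0 < ε₀)
    (u u' : (Fin n → Fin n → ℝ) × (Fin n → ℝ))
    (hu : inOmega εS u) (hu' : inOmega εS u')
    (hSu : frob (diagT u.2) ≤ R) (hSu' : frob (diagT u'.2) ≤ R)
    (hclose : paramNorm (u - u') ≤ 2 * ε₀) :
    frob (Fmap u - Fmap u' - fderiv ℝ Fmap u' (u - u')) ≤
      ((n : ℝ) ^ 2 * ((n : ℝ) + 1) ^ 2 * max (3 * R) 1) * paramNorm (u - u') ^ 2 := by
  have hnonneg : 0 ≤ paramNormSq (u - u') := by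
    unfold paramNormSq
    positivity
  have hsq : paramNorm (u - u') ^ 2 = paramNormSq (u - u') := Real.sq_sqrt hnonneg
  have hfrob := frob_le_of_forall_abs_le (by positivity) (abs_Fmap_taylor_remainder_apply_le
    (abs_apply_le_one_of_transpose_mul_self hu.1) (abs_apply_le_one_of_transpose_mul_self hu'.1)
    (fun p => (abs_le_frob_diagT u.2 p).trans hSu))
  rw [hsq]
  refine hfrob.trans ?_
  rcases Nat.eq_zero_or_pos n with rfl | hn
  · simp
  · have hn1 : (1 : ℝ) ≤ n := by exact_mod_cast hn
    have h4 : (4 : ℝ) ≤ ((n : ℝ) + 1) ^ 2 := by nlinarith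
    calc (n : ℝ) ^ 2 * (4 * max (3 * R) 1 * paramNormSq (u - u'))
        = (n : ℝ) ^ 2 * 4 * max (3 * R) 1 * paramNormSq (u - u') := by ring
      _ ≤ _ := by gcongr
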